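/- arXiv:2102.06879 — 6 statements merged into one kernel-verified Lean document; each statement's English description precedes it below -/
import Mathlib

section
/- Unbiased risk expression from dissimilar pairs (Appendix, symmetric to Theorem 1): Assume s(x,x') < 1 for ν⊗ν-a.e. (x,x'), and that x ↦ ℓ(g(x),+1) and x ↦ ℓ(g(x),−1) are integrable with respect to both μ₊ and μ₋. Then, with π_D = 2·π₊·π₋, ∫ [π_D·(s(x,x') − π₋)·(ℓ(g(x),+1) + ℓ(g(x'),+1)) + π_D·(π₊ − s(x,x'))·(ℓ(g(x),−1) + ℓ(g(x'),−1))] / (2·(π₊−π₋)·(1 − s(x,x'))) dμ_D(x,x') = R(g). -/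
open MeasureTheory ProbabilityTheory
open scoped ENNReal BigOperators

/-- Over a product measure, a symmetric kernel spanned by two normalized densities `p` and `q`,
weighted by `f x + f x'`, is integrable, and its integral reduces to those of `p f` and `q f`. -/
lemma integrable_and_integral_symm_kernel_mul_add
    {X : Type*} [MeasurableSpace X] {ν : Measure X} [SigmaFinite ν] {p q f : X → ℝ}
    (hp : Integrable p ν) (hq : Integrable q ν)
    (hpf : Integrable (fun x => p x * f x) ν) (hqf : Integrable (fun x => q x * f x) ν)
    (hp1 : ∫ x, p x ∂ν = 1) (hq1 : ∫ x, q x ∂ν = 1) (A B C : ℝ) :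
    Integrable (fun z : X × X => (A * (p z.1 * p z.2) + B * (q z.1 * q z.2) +
        C * (p z.1 * q z.2 + q z.1 * p z.2)) * (f z.1 + f z.2)) (ν.prod ν) ∧
      ∫ z : X × X, (A * (p z.1 * p z.2) + B * (q z.1 * q z.2) +
        C * (p z.1 * q z.2 + q z.1 * p z.2)) * (f z.1 + f z.2) ∂(ν.prod ν) =
        2 * ((A + C) * ∫ x, p x * f x ∂ν) + 2 * ((B + C) * ∫ x, q x * f x ∂ν) := by
  have hu : Integrable (fun x => A * p x + C * q x) ν := (hp.const_mul A).add (hq.const_mul C)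
  have hv : Integrable (fun x => B * q x + C * p x) ν := (hq.const_mul B).add (hp.const_mul C)
  have hu1 : ∫ x, (A * p x + C * q x) ∂ν = A + C := by
    rw [integral_add (hp.const_mul A) (hq.const_mul C), integral_const_mul, integral_const_mul,
      hp1, hq1, mul_one, mul_one]
  have hv1 : ∫ x, (B * q x + C * p x) ∂ν = B + C := by
    rw [integral_add (hq.const_mul B) (hp.const_mul C), integral_const_mul, integral_const_mul,
      hp1, hq1, mul_one, mul_one]
  have e : (fun z : X × X => (A * (p z.1 * p z.2) + B * (q z.1 * q z.2) +
        C * (p z.1 * q z.2 + q z.1 * p z.2)) * (f z.1 + f z.2)) =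
      fun z => ((p z.1 * f z.1) * (A * p z.2 + C * q z.2) +
        (A * p z.1 + C * q z.1) * (p z.2 * f z.2)) +
        ((q z.1 * f z.1) * (B * q z.2 + C * p z.2) +
        (B * q z.1 + C * p z.1) * (q z.2 * f z.2)) := by
    funext z
    ring
  have h1 := hpf.mul_prod hu
  have h2 := hu.mul_prod hpf
  have h3 := hqf.mul_prod hv
  have h4 := hv.mul_prod hqf
  rw [e]
  refine ⟨(h1.add h2).add (h3.add h4), ?_⟩
  rw [integral_add (by exact h1.add h2) (by exact h3.add h4), integral_add h1 h2, integral_add h3 h4,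
    integral_prod_mul (fun x => p x * f x) (fun x => A * p x + C * q x),
    integral_prod_mul (fun x => A * p x + C * q x) (fun x => p x * f x),
    integral_prod_mul (fun x => q x * f x) (fun x => B * q x + C * p x),
    integral_prod_mul (fun x => B * q x + C * p x) (fun x => q x * f x), hu1, hv1]
  ring

lemma integral_withDensity_ofReal {X : Type*} [MeasurableSpace X] {ν : Measure X} {p : X → ℝ}
    (hp : Measurable p) (hp0 : ∀ x, 0 ≤ p x) (f : X → ℝ) :
    ∫ x, f x ∂(ν.withDensity fun x => ENNReal.ofReal (p x)) = ∫ x, p x * f x ∂ν := by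
  rw [integral_withDensity_eq_integral_toReal_smul hp.ennreal_ofReal (by simp)]
  simp [ENNReal.toReal_ofReal (hp0 _)]

lemma integrable_withDensity_ofReal_iff {X : Type*} [MeasurableSpace X] {ν : Measure X}
    {p : X → ℝ} (hp : Measurable p) (hp0 : ∀ x, 0 ≤ p x) {f : X → ℝ} :
    Integrable f (ν.withDensity fun x => ENNReal.ofReal (p x)) ↔
      Integrable (fun x => p x * f x) ν := by
  rw [integrable_withDensity_iff_integrable_smul' hp.ennreal_ofReal (by simp)]
  simp [ENNReal.toReal_ofReal (hp0 _)]

theorem sconf_dissimilar_pairs_unbiased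
    {X : Type*} [MeasurableSpace X] (ν : Measure X) [SigmaFinite ν]
    (pp pm : X → ℝ) (hppm : Measurable pp) (hpmm : Measurable pm)
    (hpp0 : ∀ x, 0 ≤ pp x) (hpm0 : ∀ x, 0 ≤ pm x)
    (μp μm : Measure X) [IsProbabilityMeasure μp] [IsProbabilityMeasure μm]
    (hμp : μp = ν.withDensity fun x => ENNReal.ofReal (pp x))
    (hμm : μm = ν.withDensity fun x => ENNReal.ofReal (pm x))
    (πp πm : ℝ) (hπp0 : 0 < πp) (hπp1 : πp < 1) (hπm : πm = 1 - πp)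
    (hpos : ∀ᵐ x ∂ν, 0 < πp * pp x + πm * pm x)
    (μ : Measure X) [IsProbabilityMeasure μ]
    (hμ : μ = ENNReal.ofReal πp • μp + ENNReal.ofReal πm • μm)
    (s : X → X → ℝ)
    (hs : ∀ x x', s x x' = (πp ^ 2 * pp x * pp x' + πm ^ 2 * pm x * pm x') /
        ((πp * pp x + πm * pm x) * (πp * pp x' + πm * pm x')))
    (hne : πp ≠ πm)
    (ℓ : ℝ → ℝ → ℝ)
    (hℓm1 : Measurable fun z => ℓ z 1) (hℓm2 : Measurable fun z => ℓ z (-1))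
    (hℓ01 : ∀ z, 0 ≤ ℓ z 1) (hℓ02 : ∀ z, 0 ≤ ℓ z (-1))
    (g : X → ℝ) (hg : Measurable g)
    (hip1 : Integrable (fun x => ℓ (g x) 1) μp) (him1 : Integrable (fun x => ℓ (g x) 1) μm)
    (hip2 : Integrable (fun x => ℓ (g x) (-1)) μp) (him2 : Integrable (fun x => ℓ (g x) (-1)) μm)
    (hslt1 : ∀ᵐ q ∂(ν.prod ν), s q.1 q.2 < 1)
    (πD : ℝ) (hπD : πD = 2 * πp * πm)
    (μD : Measure (X × X))
    (hμD : μD = (ν.prod ν).withDensity fun q =>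
      ENNReal.ofReal ((pp q.1 * pm q.2 + pm q.1 * pp q.2) / 2)) :
    (∫ q : X × X,
        (πD * (s q.1 q.2 - πm) * (ℓ (g q.1) 1 + ℓ (g q.2) 1) +
          πD * (πp - s q.1 q.2) * (ℓ (g q.1) (-1) + ℓ (g q.2) (-1))) /
          (2 * (πp - πm) * (1 - s q.1 q.2)) ∂μD)
      = πp * (∫ x, ℓ (g x) 1 ∂μp) + πm * ∫ x, ℓ (g x) (-1) ∂μm := by
  have hpp_int : Integrable pp ν := by
    have h := integrable_const (μ := μp) (1 : ℝ)
    rw [hμp, integrable_withDensity_ofReal_iff hppm hpp0] at h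
    simpa only [mul_one] using h
  have hpm_int : Integrable pm ν := by
    have h := integrable_const (μ := μm) (1 : ℝ)
    rw [hμm, integrable_withDensity_ofReal_iff hpmm hpm0] at h
    simpa only [mul_one] using h
  have hpp_one : ∫ x, pp x ∂ν = 1 := by
    have h := integral_withDensity_ofReal (ν := ν) hppm hpp0 fun _ => 1
    rw [← hμp] at h
    simpa using h.symm
  have hpm_one : ∫ x, pm x ∂ν = 1 := by
    have h := integral_withDensity_ofReal (ν := ν) hpmm hpm0 fun _ => 1
    rw [← hμm] at h
    simpa using h.symm
  rw [hμp, integrable_withDensity_ofReal_iff hppm hpp0] at hip1 hip2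
  rw [hμm, integrable_withDensity_ofReal_iff hpmm hpm0] at him1 him2
  have hd0 : ∀ q : X × X, 0 ≤ (pp q.1 * pm q.2 + pm q.1 * pp q.2) / 2 := fun q => by
    have := mul_nonneg (hpp0 q.1) (hpm0 q.2)
    have := mul_nonneg (hpm0 q.1) (hpp0 q.2)
    positivity
  have hdm : Measurable fun q : X × X => (pp q.1 * pm q.2 + pm q.1 * pp q.2) / 2 := by fun_prop
  obtain ⟨hI1, hE1⟩ := integrable_and_integral_symm_kernel_mul_add hpp_int hpm_int hip1 him1
    hpp_one hpm_one (πp ^ 2 - πm * πp ^ 2) (πm ^ 2 - πm * πm ^ 2) (-(πm * (πp * πm)))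
  obtain ⟨hI2, hE2⟩ := integrable_and_integral_symm_kernel_mul_add hpp_int hpm_int hip2 him2
    hpp_one hpm_one (πp * πp ^ 2 - πp ^ 2) (πp * πm ^ 2 - πm ^ 2) (πp * (πp * πm))
  have hne' : πp - πm ≠ 0 := sub_ne_zero.2 hne
  rw [hμD, hμp, hμm, integral_withDensity_ofReal hdm hd0, integral_withDensity_ofReal hppm hpp0,
    integral_withDensity_ofReal hpmm hpm0]
  have key := integral_add hI1 hI2
  rw [hE1, hE2] at key
  calc
    _ = ∫ q : X × X, (2 * (πp - πm))⁻¹ * _ ∂(ν.prod ν) := integral_congr_ae ?_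
    _ = _ := by
      rw [integral_const_mul, key]
      field_simp
      subst hπm
      ring
  filter_upwards [hslt1, Measure.quasiMeasurePreserving_fst.ae hpos,
    Measure.quasiMeasurePreserving_snd.ae hpos] with q hq h1 h2
  have hsP : s q.1 q.2 * ((πp * pp q.1 + πm * pm q.1) * (πp * pp q.2 + πm * pm q.2)) =
      πp ^ 2 * pp q.1 * pp q.2 + πm ^ 2 * pm q.1 * pm q.2 := by
    rw [hs, div_mul_cancel₀ _ (mul_pos h1 h2).ne']
  have hq' : 1 - s q.1 q.2 ≠ 0 := (sub_pos.2 hq).ne'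
  generalize s q.1 q.2 = t at *
  generalize pp q.1 = a at *
  generalize pp q.2 = a' at *
  generalize pm q.1 = b at *
  generalize pm q.2 = b' at *
  generalize ℓ (g q.1) 1 + ℓ (g q.2) 1 = L
  generalize ℓ (g q.1) (-1) + ℓ (g q.2) (-1) = M
  have hw : (a * b' + b * a') / 2 * πD =
      (1 - t) * ((πp * a + πm * b) * (πp * a' + πm * b')) := by
    rw [hπD]
    linear_combination hsP
  calc
    _ = (a * b' + b * a') / 2 * πD * ((t - πm) * L + (πp - t) * M) /
        (2 * (πp - πm) * (1 - t)) := by ring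
    _ = (2 * (πp - πm))⁻¹ * (((πp * a + πm * b) * (πp * a' + πm * b')) *
        ((t - πm) * L + (πp - t) * M)) := by
      rw [hw]
      field_simp
    _ = _ := by
      congr 1
      linear_combination (L - M) * hsP
end

section
/- Collapse of learning from only dissimilar pairs (Appendix, symmetric to Theorem 2): Suppose π₊ > π₋ and sᵢ ≤ π₋ for all i = 1,…,n. Then for every function g: 𝒳 → ℝ, R̂_D(g) ≥ π_D·Σᵢ (sᵢ − π₋)/(n·(π₊−π₋)·(1−sᵢ)), and equality holds for any g with g(x) ≤ 0 for all x ∈ 𝒳. Consequently every classifier that labels all points negative is a minimizer of R̂_D over all functions g: 𝒳 → ℝ, i.e., the empirical risk minimizer of R̂_D is a collapsed solution. -/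
open MeasureTheory ProbabilityTheory
open scoped ENNReal BigOperators

theorem sconf_dissimilar_only_collapse
    {X : Type*} [Nonempty X]
    (πp πm : ℝ) (hπp0 : 0 < πp) (hπp1 : πp < 1) (hπm : πm = 1 - πp)
    (hππ : πm < πp)
    (πD : ℝ) (hπD : πD = 2 * πp * πm)
    (n : ℕ) (hn : 0 < n)
    (x x' : Fin n → X) (sc : Fin n → ℝ) (hsc : ∀ i, sc i ∈ Set.Ico (0 : ℝ) 1)
    (hscπ : ∀ i, sc i ≤ πm)
    (ℓpos ℓneg : ℝ → ℝ)
    (hℓpos : ∀ z, ℓpos z = if 0 < z then 0 else 1)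
    (hℓneg : ∀ z, ℓneg z = if 0 < z then 1 else 0)
    (RhatD : (X → ℝ) → ℝ)
    (hRhatD : ∀ g, RhatD g = πD * ∑ i,
      ((sc i - πm) * (ℓpos (g (x i)) + ℓpos (g (x' i))) +
        (πp - sc i) * (ℓneg (g (x i)) + ℓneg (g (x' i)))) /
        (2 * (n : ℝ) * (πp - πm) * (1 - sc i))) :
    (∀ g : X → ℝ, πD * (∑ i, (sc i - πm) / ((n : ℝ) * (πp - πm) * (1 - sc i))) ≤ RhatD g) ∧
    (∀ g : X → ℝ, (∀ z, g z ≤ 0) →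
      RhatD g = πD * ∑ i, (sc i - πm) / ((n : ℝ) * (πp - πm) * (1 - sc i))) ∧
    (∀ g : X → ℝ, (∀ z, g z ≤ 0) → ∀ g' : X → ℝ, RhatD g ≤ RhatD g') := by
  have hneg : ∀ g : X → ℝ, (∀ z, g z ≤ 0) →
      RhatD g = πD * ∑ i, (sc i - πm) / ((n : ℝ) * (πp - πm) * (1 - sc i)) := by
    intro g hg
    rw [hRhatD]
    congr 1
    refine Finset.sum_congr rfl fun i _ => ?_
    simp only [hℓpos, hℓneg, not_lt.mpr (hg _), if_false]
    rw [show (2 : ℝ) * n * (πp - πm) * (1 - sc i) = 2 * (n * (πp - πm) * (1 - sc i)) by ring,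
      show (sc i - πm) * (1 + 1) + (πp - sc i) * (0 + 0) = 2 * (sc i - πm) by ring,
      mul_div_mul_left _ _ two_ne_zero]
  have hle : ∀ g : X → ℝ,
      πD * (∑ i, (sc i - πm) / ((n : ℝ) * (πp - πm) * (1 - sc i))) ≤ RhatD g := by
    intro g
    have hloss : ∀ i z, sc i - πm ≤ (sc i - πm) * ℓpos z + (πp - sc i) * ℓneg z := by
      intro i z
      rw [hℓpos, hℓneg]
      have := hscπ i
      split_ifs <;> linarith
    have hπD0 : 0 ≤ πD := by
      have : 0 ≤ πm := by linarith
      rw [hπD]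
      positivity
    rw [← hneg (fun _ => 0) fun _ => le_rfl, hRhatD, hRhatD]
    refine mul_le_mul_of_nonneg_left (Finset.sum_le_sum fun i _ => ?_) hπD0
    have h1 : 0 ≤ πp - πm := by linarith
    have h2 : 0 ≤ 1 - sc i := by linarith [(hsc i).2]
    refine div_le_div_of_nonneg_right ?_ (by positivity)
    have h3 := hloss i (g (x i))
    have h4 := hloss i (g (x' i))
    rw [hℓpos 0, hℓneg 0, if_neg (lt_irrefl _), if_neg (lt_irrefl _)]
    linarith
  exact ⟨hle, hneg, fun g hg g' => (hneg g hg).trans_le (hle g')⟩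
end

section
/- Equivalent expression of similarity confidence (Lemma 1): Let ((X,Y),(X',Y')) be distributed according to Q ⊗ Q, i.e., two i.i.d. labeled examples. Then s(X,X') is a version of the conditional probability that the two labels agree given the two instances: E[1{Y = Y'} | σ(X,X')] = s(X,X') almost surely, where σ(X,X') is the σ-algebra generated by the pair of instances. -/
open MeasureTheory ProbabilityTheory
open scoped ENNReal BigOperators

theorem lintegral_labeled {X : Type*} [MeasurableSpace X] {ν : Measure X} {pp pm : X → ℝ}
    (hppm : Measurable pp) (hpmm : Measurable pm) {a b : ℝ} (ha : 0 ≤ a) (hb : 0 ≤ b)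
    [SFinite (ν.withDensity fun x => ENNReal.ofReal (pp x))]
    [SFinite (ν.withDensity fun x => ENNReal.ofReal (pm x))]
    {F : X × ℝ → ℝ≥0∞} (hF : Measurable F) :
    ∫⁻ q, F q ∂(ENNReal.ofReal a •
          ((ν.withDensity fun x => ENNReal.ofReal (pp x)).prod (Measure.dirac (1 : ℝ))) +
        ENNReal.ofReal b •
          ((ν.withDensity fun x => ENNReal.ofReal (pm x)).prod (Measure.dirac (-1 : ℝ)))) =
      ∫⁻ x, (ENNReal.ofReal (a * pp x) * F (x, 1) + ENNReal.ofReal (b * pm x) * F (x, -1)) ∂ν := by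
  have hF1 : Measurable fun x => F (x, (1 : ℝ)) := by fun_prop
  have hF2 : Measurable fun x => F (x, (-1 : ℝ)) := by fun_prop
  rw [lintegral_add_measure, lintegral_smul_measure, lintegral_smul_measure,
    lintegral_prod _ hF.aemeasurable, lintegral_prod _ hF.aemeasurable]
  simp only [lintegral_dirac]
  rw [lintegral_withDensity_eq_lintegral_mul _ hppm.ennreal_ofReal hF1,
    lintegral_withDensity_eq_lintegral_mul _ hpmm.ennreal_ofReal hF2,
    smul_eq_mul, smul_eq_mul,
    ← lintegral_const_mul _ (hppm.ennreal_ofReal.mul hF1),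
    ← lintegral_const_mul _ (hpmm.ennreal_ofReal.mul hF2),
    ← lintegral_add_left ((hppm.ennreal_ofReal.mul hF1).const_mul _)]
  simp only [Pi.mul_apply, ENNReal.ofReal_mul ha, ENNReal.ofReal_mul hb, mul_assoc]

theorem lintegral_labeled_prod {X : Type*} [MeasurableSpace X] {ν : Measure X} [SFinite ν]
    {α β : X → ℝ≥0∞} (hα : Measurable α) (hβ : Measurable β)
    {Q : Measure (X × ℝ)} [SFinite Q]
    (hQ : ∀ F : X × ℝ → ℝ≥0∞, Measurable F →
      ∫⁻ q, F q ∂Q = ∫⁻ x, (α x * F (x, 1) + β x * F (x, -1)) ∂ν)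
    {F : (X × ℝ) × (X × ℝ) → ℝ≥0∞} (hF : Measurable F) :
    ∫⁻ q, F q ∂(Q.prod Q) = ∫⁻ x, ∫⁻ x',
      (α x * (α x' * F ((x, 1), (x', 1)) + β x' * F ((x, 1), (x', -1))) +
        β x * (α x' * F ((x, -1), (x', 1)) + β x' * F ((x, -1), (x', -1)))) ∂ν ∂ν := by
  rw [lintegral_prod _ hF.aemeasurable, hQ _ hF.lintegral_prod_right']
  refine lintegral_congr fun x => ?_
  rw [hQ _ (by fun_prop), hQ _ (by fun_prop), ← lintegral_const_mul _ (by fun_prop),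
    ← lintegral_const_mul _ (by fun_prop), ← lintegral_add_left (by fun_prop)]

theorem similarity_nonneg_and_le_one {a b c d : ℝ} (ha : 0 ≤ a) (hb : 0 ≤ b) (hc : 0 ≤ c)
    (hd : 0 ≤ d) :
    0 ≤ (a * c + b * d) / ((a + b) * (c + d)) ∧ (a * c + b * d) / ((a + b) * (c + d)) ≤ 1 := by
  refine ⟨by positivity, div_le_one_of_le₀ ?_ (by positivity)⟩
  nlinarith [mul_nonneg ha hd, mul_nonneg hb hc]

theorem ofReal_mul_similarity {a b c d : ℝ} (ha : 0 ≤ a) (hb : 0 ≤ b) (hc : 0 ≤ c)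
    (hd : 0 ≤ d) :
    (ENNReal.ofReal a + ENNReal.ofReal b) * (ENNReal.ofReal c + ENNReal.ofReal d) *
        ENNReal.ofReal ((a * c + b * d) / ((a + b) * (c + d))) =
      ENNReal.ofReal a * ENNReal.ofReal c + ENNReal.ofReal b * ENNReal.ofReal d := by
  rw [← ENNReal.ofReal_add ha hb, ← ENNReal.ofReal_add hc hd,
    ← ENNReal.ofReal_mul (by positivity), ← ENNReal.ofReal_mul (by positivity),
    ← ENNReal.ofReal_mul ha, ← ENNReal.ofReal_mul hb,
    ← ENNReal.ofReal_add (by positivity) (by positivity)]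
  congr 1
  refine mul_div_cancel_of_imp' fun h => ?_
  rcases mul_eq_zero.1 h with h | h
  · obtain ⟨rfl, rfl⟩ := (add_eq_zero_iff_of_nonneg ha hb).1 h
    simp
  · obtain ⟨rfl, rfl⟩ := (add_eq_zero_iff_of_nonneg hc hd).1 h
    simp

theorem sconf_similarity_confidence_condexp
    {X : Type*} [MeasurableSpace X] (ν : Measure X) [SigmaFinite ν]
    (pp pm : X → ℝ) (hppm : Measurable pp) (hpmm : Measurable pm)
    (hpp0 : ∀ x, 0 ≤ pp x) (hpm0 : ∀ x, 0 ≤ pm x)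
    (μp μm : Measure X) [IsProbabilityMeasure μp] [IsProbabilityMeasure μm]
    (hμp : μp = ν.withDensity fun x => ENNReal.ofReal (pp x))
    (hμm : μm = ν.withDensity fun x => ENNReal.ofReal (pm x))
    (πp πm : ℝ) (hπp0 : 0 < πp) (hπp1 : πp < 1) (hπm : πm = 1 - πp)
    (hpos : ∀ᵐ x ∂ν, 0 < πp * pp x + πm * pm x)
    (μ : Measure X) [IsProbabilityMeasure μ]
    (hμ : μ = ENNReal.ofReal πp • μp + ENNReal.ofReal πm • μm)
    (s : X → X → ℝ)
    (hs : ∀ x x', s x x' = (πp ^ 2 * pp x * pp x' + πm ^ 2 * pm x * pm x') /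
        ((πp * pp x + πm * pm x) * (πp * pp x' + πm * pm x')))
    (Q : Measure (X × ℝ))
    (hQ : Q = ENNReal.ofReal πp • (μp.prod (Measure.dirac (1 : ℝ))) +
        ENNReal.ofReal πm • (μm.prod (Measure.dirac (-1 : ℝ)))) :
    (Q.prod Q)[(fun q : (X × ℝ) × (X × ℝ) => if q.1.2 = q.2.2 then (1 : ℝ) else 0) |
        MeasurableSpace.comap (fun q : (X × ℝ) × (X × ℝ) => (q.1.1, q.2.1)) inferInstance]
      =ᵐ[Q.prod Q] fun q : (X × ℝ) × (X × ℝ) => s q.1.1 q.2.1 := by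
  have hπm0 : 0 < πm := by linarith
  have hα0 : ∀ x, 0 ≤ πp * pp x := fun x => mul_nonneg hπp0.le (hpp0 x)
  have hβ0 : ∀ x, 0 ≤ πm * pm x := fun x => mul_nonneg hπm0.le (hpm0 x)
  have hs' : ∀ x x', s x x' = (πp * pp x * (πp * pp x') + πm * pm x * (πm * pm x')) /
      ((πp * pp x + πm * pm x) * (πp * pp x' + πm * pm x')) := fun x x' => by
    rw [hs]; ring
  have hs01 : ∀ x x', 0 ≤ s x x' ∧ s x x' ≤ 1 := fun x x' => by
    rw [hs']; exact similarity_nonneg_and_le_one (hα0 x) (hβ0 x) (hα0 x') (hβ0 x')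
  have hsm : Measurable fun z : X × X => s z.1 z.2 := by
    simp only [hs]; fun_prop
  have hQfin : IsFiniteMeasure Q := by
    rw [hQ]
    have h1 := (μp.prod (Measure.dirac (1 : ℝ))).smul_finite (ENNReal.ofReal_ne_top (r := πp))
    have h2 := (μm.prod (Measure.dirac (-1 : ℝ))).smul_finite (ENNReal.ofReal_ne_top (r := πm))
    infer_instance
  have hQF : ∀ F : X × ℝ → ℝ≥0∞, Measurable F → ∫⁻ q, F q ∂Q = ∫⁻ x,
      (ENNReal.ofReal (πp * pp x) * F (x, 1) + ENNReal.ofReal (πm * pm x) * F (x, -1)) ∂ν := by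
    intro F hF
    subst hμp hμm
    rw [hQ]
    exact lintegral_labeled hppm hpmm hπp0.le hπm0.le hF
  have hproj : Measurable fun q : (X × ℝ) × (X × ℝ) => (q.1.1, q.2.1) := by fun_prop
  have hfm : Measurable fun q : (X × ℝ) × (X × ℝ) => if q.1.2 = q.2.2 then (1 : ℝ) else 0 :=
    Measurable.ite (measurableSet_eq_fun (by fun_prop) (by fun_prop)) measurable_const
      measurable_const
  have hgm : Measurable fun q : (X × ℝ) × (X × ℝ) => s q.1.1 q.2.1 := hsm.comp hproj
  have hgi : Integrable (fun q : (X × ℝ) × (X × ℝ) => s q.1.1 q.2.1) (Q.prod Q) :=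
    Integrable.of_bound hgm.aestronglyMeasurable 1 (ae_of_all _ fun q => by
      rw [Real.norm_of_nonneg (hs01 _ _).1]; exact (hs01 _ _).2)
  have hfi : Integrable
      (fun q : (X × ℝ) × (X × ℝ) => if q.1.2 = q.2.2 then (1 : ℝ) else 0) (Q.prod Q) :=
    Integrable.of_bound hfm.aestronglyMeasurable 1 (ae_of_all _ fun q => by
      split_ifs <;> simp)
  refine (ae_eq_condExp_of_forall_setIntegral_eq hproj.comap_le hfi
    (fun _ _ _ => hgi.integrableOn) ?_ ?_).symm
  · rintro _ ⟨B, hB, rfl⟩ -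
    rw [integral_eq_lintegral_of_nonneg_ae (ae_of_all _ fun q => (hs01 _ _).1)
        hgm.aestronglyMeasurable,
      integral_eq_lintegral_of_nonneg_ae
        (ae_of_all _ fun q => by split_ifs <;> simp) hfm.aestronglyMeasurable,
      ← lintegral_indicator (hproj hB), ← lintegral_indicator (hproj hB),
      lintegral_labeled_prod (by fun_prop) (by fun_prop) hQF
        (hgm.ennreal_ofReal.indicator (hproj hB)),
      lintegral_labeled_prod (by fun_prop) (by fun_prop) hQF
        (hfm.ennreal_ofReal.indicator (hproj hB))]
    congr 1
    refine lintegral_congr fun x => lintegral_congr fun x' => ?_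
    by_cases hx : (x, x') ∈ B
    · have h1 : (1 : ℝ) ≠ -1 := by norm_num
      have h := ofReal_mul_similarity (hα0 x) (hβ0 x) (hα0 x') (hβ0 x')
      rw [← hs'] at h
      simp only [Set.indicator, Set.mem_preimage, hx, if_true, h1, h1.symm, if_false,
        ENNReal.ofReal_one, ENNReal.ofReal_zero, mul_one, mul_zero, add_zero, zero_add]
      rw [← h]
      ring
    · simp [Set.indicator, hx]
  · exact (hsm.comp (comap_measurable _)).stronglyMeasurable.aestronglyMeasurable
end

section
/- Unbiasedness of the partial risk estimators (Lemma 2): Assume x ↦ ℓ(g(x),+1) and x ↦ ℓ(g(x),−1) are integrable with respect to both μ₊ and μ₋. Then (i) ∫∫ (s(x,x') − π₋)·(ℓ(g(x),+1) + ℓ(g(x'),+1))/(2·(π₊−π₋)) dμ(x) dμ(x') = π₊·∫ ℓ(g(x),+1) dμ₊(x), and (ii) ∫∫ (π₊ − s(x,x'))·(ℓ(g(x),−1) + ℓ(g(x'),−1))/(2·(π₊−π₋)) dμ(x) dμ(x') = π₋·∫ ℓ(g(x),−1) dμ₋(x). -/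
open MeasureTheory ProbabilityTheory
open scoped ENNReal BigOperators

/-- Integrability transfers along a change of density: if `p * a = c * q` almost everywhere and `f` is
integrable for the measure with density `q`, then `a * f` is integrable for the one with density `p`. -/
theorem integrable_mul_withDensity_ofReal {X : Type*} [MeasurableSpace X] {ν : Measure X}
    {p q a f : X → ℝ} {c : ℝ} (hp : Measurable p) (hq : Measurable q)
    (hp0 : ∀ x, 0 ≤ p x) (hq0 : ∀ x, 0 ≤ q x) (h : ∀ᵐ x ∂ν, p x * a x = c * q x)
    (hf : Integrable f (ν.withDensity fun x => ENNReal.ofReal (q x))) :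
    Integrable (fun x => a x * f x) (ν.withDensity fun x => ENNReal.ofReal (p x)) := by
  rw [integrable_withDensity_iff_integrable_smul' hq.ennreal_ofReal (by simp)] at hf
  rw [integrable_withDensity_iff_integrable_smul' hp.ennreal_ofReal (by simp)]
  refine (hf.const_mul c).congr ?_
  filter_upwards [h] with x hx
  simp only [ENNReal.toReal_ofReal (hp0 x), ENNReal.toReal_ofReal (hq0 x), smul_eq_mul]
  rw [← mul_assoc, ← mul_assoc, hx]

/-- Change of density: if `p * a = c * q` almost everywhere, then integrating `a * f` against the density
`p` is `c` times integrating `f` against the density `q`. -/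
theorem integral_mul_withDensity_ofReal {X : Type*} [MeasurableSpace X] {ν : Measure X}
    {p q a f : X → ℝ} {c : ℝ} (hp : Measurable p) (hq : Measurable q)
    (hp0 : ∀ x, 0 ≤ p x) (hq0 : ∀ x, 0 ≤ q x) (h : ∀ᵐ x ∂ν, p x * a x = c * q x) :
    ∫ x, a x * f x ∂(ν.withDensity fun x => ENNReal.ofReal (p x))
      = c * ∫ x, f x ∂(ν.withDensity fun x => ENNReal.ofReal (q x)) := by
  rw [integral_withDensity_eq_integral_toReal_smul hp.ennreal_ofReal (by simp),
    integral_withDensity_eq_integral_toReal_smul hq.ennreal_ofReal (by simp),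
    ← integral_const_mul]
  refine integral_congr_ae ?_
  filter_upwards [h] with x hx
  simp only [ENNReal.toReal_ofReal (hp0 x), ENNReal.toReal_ofReal (hq0 x), smul_eq_mul]
  rw [← mul_assoc, ← mul_assoc, hx]

/-- The double integral of `(a x * a x' + b x * b x' - c) * (L x + L x') * k`, by expanding the product. -/
theorem integral_integral_rank_two_sub_mul_add {X : Type*} [MeasurableSpace X] (μ : Measure X)
    [IsProbabilityMeasure μ] {a b L : X → ℝ} (c k : ℝ) (ha : Integrable a μ) (hb : Integrable b μ)
    (hL : Integrable L μ) (haL : Integrable (fun x => a x * L x) μ)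
    (hbL : Integrable (fun x => b x * L x) μ) :
    ∫ x, ∫ x', (a x * a x' + b x * b x' - c) * (L x + L x') * k ∂μ ∂μ
      = 2 * k * ((∫ x, a x ∂μ) * (∫ x, a x * L x ∂μ) + (∫ x, b x ∂μ) * (∫ x, b x * L x ∂μ)
          - c * ∫ x, L x ∂μ) := by
  have expand (t u v w z r : ℝ) :
      ∫ x, (t * a x + u * b x + v * L x + w * (a x * L x) + z * (b x * L x) + r) ∂μ
        = t * ∫ x, a x ∂μ + u * ∫ x, b x ∂μ + v * ∫ x, L x ∂μ + w * ∫ x, a x * L x ∂μ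
          + z * ∫ x, b x * L x ∂μ + r := by
    rw [integral_add (by fun_prop) (by fun_prop), integral_add (by fun_prop) (by fun_prop),
      integral_add (by fun_prop) (by fun_prop), integral_add (by fun_prop) (by fun_prop),
      integral_add (by fun_prop) (by fun_prop)]
    simp [integral_const_mul]
  have inner (x : X) : ∫ x', (a x * a x' + b x * b x' - c) * (L x + L x') * k ∂μ
      = (k * ∫ x, a x * L x ∂μ) * a x + (k * ∫ x, b x * L x ∂μ) * b x + (-c * k) * L x
        + (k * ∫ x, a x ∂μ) * (a x * L x) + (k * ∫ x, b x ∂μ) * (b x * L x)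
        + (-c * k * ∫ x, L x ∂μ) := by
    have := expand (a x * L x * k) (b x * L x * k) (-c * k) (a x * k) (b x * k) (-c * L x * k)
    calc _ = _ := integral_congr_ae (.of_forall fun x' => by ring)
      _ = _ := this
      _ = _ := by ring
  simp_rw [inner]
  rw [expand]
  ring

theorem sconf_partial_risk_unbiased
    {X : Type*} [MeasurableSpace X] (ν : Measure X) [SigmaFinite ν]
    (pp pm : X → ℝ) (hppm : Measurable pp) (hpmm : Measurable pm)
    (hpp0 : ∀ x, 0 ≤ pp x) (hpm0 : ∀ x, 0 ≤ pm x)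
    (μp μm : Measure X) [IsProbabilityMeasure μp] [IsProbabilityMeasure μm]
    (hμp : μp = ν.withDensity fun x => ENNReal.ofReal (pp x))
    (hμm : μm = ν.withDensity fun x => ENNReal.ofReal (pm x))
    (πp πm : ℝ) (hπp0 : 0 < πp) (hπp1 : πp < 1) (hπm : πm = 1 - πp)
    (hpos : ∀ᵐ x ∂ν, 0 < πp * pp x + πm * pm x)
    (μ : Measure X) [IsProbabilityMeasure μ]
    (hμ : μ = ENNReal.ofReal πp • μp + ENNReal.ofReal πm • μm)
    (s : X → X → ℝ)
    (hs : ∀ x x', s x x' = (πp ^ 2 * pp x * pp x' + πm ^ 2 * pm x * pm x') /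
        ((πp * pp x + πm * pm x) * (πp * pp x' + πm * pm x')))
    (hne : πp ≠ πm)
    (ℓ : ℝ → ℝ → ℝ)
    (hℓm1 : Measurable fun z => ℓ z 1) (hℓm2 : Measurable fun z => ℓ z (-1))
    (hℓ01 : ∀ z, 0 ≤ ℓ z 1) (hℓ02 : ∀ z, 0 ≤ ℓ z (-1))
    (g : X → ℝ) (hg : Measurable g)
    (hip1 : Integrable (fun x => ℓ (g x) 1) μp) (him1 : Integrable (fun x => ℓ (g x) 1) μm)
    (hip2 : Integrable (fun x => ℓ (g x) (-1)) μp) (him2 : Integrable (fun x => ℓ (g x) (-1)) μm)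
    :
    (∫ x, ∫ x', (s x x' - πm) * (ℓ (g x) 1 + ℓ (g x') 1) / (2 * (πp - πm)) ∂μ ∂μ
        = πp * ∫ x, ℓ (g x) 1 ∂μp) ∧
    (∫ x, ∫ x', (πp - s x x') * (ℓ (g x) (-1) + ℓ (g x') (-1)) / (2 * (πp - πm)) ∂μ ∂μ
        = πm * ∫ x, ℓ (g x) (-1) ∂μm) := by
  have hπm0 : 0 < πm := by linarith
  have hd : πp - πm ≠ 0 := sub_ne_zero.mpr hne
  set p : X → ℝ := fun x => πp * pp x + πm * pm x with hp
  set a : X → ℝ := fun x => πp * pp x / p x with ha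
  set b : X → ℝ := fun x => πm * pm x / p x with hb
  have hpmeas : Measurable p := by fun_prop
  have hp0 (x : X) : 0 ≤ p x :=
    add_nonneg (mul_nonneg hπp0.le (hpp0 x)) (mul_nonneg hπm0.le (hpm0 x))
  have hμ_density : μ = ν.withDensity fun x => ENNReal.ofReal (p x) := by
    rw [hμ, hμp, hμm, ← withDensity_smul _ hppm.ennreal_ofReal,
      ← withDensity_smul _ hpmm.ennreal_ofReal,
      ← withDensity_add_left (hppm.ennreal_ofReal.const_smul _)]
    congr 1
    ext x
    simp only [Pi.add_apply, Pi.smul_apply, smul_eq_mul, hp]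
    rw [ENNReal.ofReal_add (mul_nonneg hπp0.le (hpp0 x)) (mul_nonneg hπm0.le (hpm0 x)),
      ENNReal.ofReal_mul hπp0.le, ENNReal.ofReal_mul hπm0.le]
  have hpa : ∀ᵐ x ∂ν, p x * a x = πp * pp x := by
    filter_upwards [hpos] with x hx using mul_div_cancel₀ _ hx.ne'
  have hpb : ∀ᵐ x ∂ν, p x * b x = πm * pm x := by
    filter_upwards [hpos] with x hx using mul_div_cancel₀ _ hx.ne'
  have int_a {f : X → ℝ} (hf : Integrable f μp) : Integrable (fun x => a x * f x) μ := by
    rw [hμ_density]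
    exact integrable_mul_withDensity_ofReal hpmeas hppm hp0 hpp0 hpa (hμp ▸ hf)
  have int_b {f : X → ℝ} (hf : Integrable f μm) : Integrable (fun x => b x * f x) μ := by
    rw [hμ_density]
    exact integrable_mul_withDensity_ofReal hpmeas hpmm hp0 hpm0 hpb (hμm ▸ hf)
  have eq_a (f : X → ℝ) : ∫ x, a x * f x ∂μ = πp * ∫ x, f x ∂μp := by
    rw [hμ_density, hμp]
    exact integral_mul_withDensity_ofReal hpmeas hppm hp0 hpp0 hpa
  have eq_b (f : X → ℝ) : ∫ x, b x * f x ∂μ = πm * ∫ x, f x ∂μm := by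
    rw [hμ_density, hμm]
    exact integral_mul_withDensity_ofReal hpmeas hpmm hp0 hpm0 hpb
  have ha_int : Integrable a μ := by simpa using int_a (integrable_const 1)
  have hb_int : Integrable b μ := by simpa using int_b (integrable_const 1)
  have ha_eq : ∫ x, a x ∂μ = πp := by simpa using eq_a fun _ => 1
  have hb_eq : ∫ x, b x ∂μ = πm := by simpa using eq_b fun _ => 1
  have hs' (x x' : X) : s x x' = a x * a x' + b x * b x' := by
    rw [hs]
    simp only [ha, hb, div_mul_div_comm, ← add_div]
    congr 1
    ring
  have risk (L : X → ℝ) (c k : ℝ) (hLp : Integrable L μp) (hLm : Integrable L μm) :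
      ∫ x, ∫ x', (s x x' - c) * (L x + L x') * k ∂μ ∂μ
        = 2 * k * ((πp - c) * (πp * ∫ x, L x ∂μp) + (πm - c) * (πm * ∫ x, L x ∂μm)) := by
    have hLp' := hLp.smul_measure (c := ENNReal.ofReal πp) ENNReal.ofReal_ne_top
    have hLm' := hLm.smul_measure (c := ENNReal.ofReal πm) ENNReal.ofReal_ne_top
    have hL : Integrable L μ := by
      rw [hμ]
      exact hLp'.add_measure hLm'
    have hL_eq : ∫ x, L x ∂μ = πp * ∫ x, L x ∂μp + πm * ∫ x, L x ∂μm := by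
      rw [hμ, integral_add_measure hLp' hLm', integral_smul_measure, integral_smul_measure,
        ENNReal.toReal_ofReal hπp0.le, ENNReal.toReal_ofReal hπm0.le, smul_eq_mul, smul_eq_mul]
    simp_rw [hs']
    rw [integral_integral_rank_two_sub_mul_add μ c k ha_int hb_int hL (int_a hLp) (int_b hLm),
      ha_eq, hb_eq, eq_a, eq_b, hL_eq]
    ring
  constructor
  · simp_rw [div_eq_mul_inv]
    rw [risk _ _ _ hip1 him1]
    field_simp
    ring
  · have hneg (x x' : X) : (πp - s x x') * (ℓ (g x) (-1) + ℓ (g x') (-1)) / (2 * (πp - πm))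
        = (s x x' - πp) * (ℓ (g x) (-1) + ℓ (g x') (-1)) * (-(2 * (πp - πm))⁻¹) := by
      rw [div_eq_mul_inv]
      ring
    simp_rw [hneg]
    rw [risk (fun x => ℓ (g x) (-1)) _ _ hip2 him2]
    field_simp
    ring
end

section
/- Weighted integral identity with one minus similarity confidence (Appendix Lemma AL2): For every measurable function h: 𝒳 → [0,∞], ∫∫ (1 − s(x,x'))·h(x) dμ(x) dμ(x') = π₊·π₋·(∫ h(x) dμ₊(x) + ∫ h(x) dμ₋(x)). -/
open MeasureTheory ProbabilityTheory
open scoped ENNReal BigOperators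

/-- A mixture of two measures with real densities has the mixture of the densities as density. -/
theorem smul_withDensity_ofReal_add_smul_withDensity_ofReal
    {X : Type*} [MeasurableSpace X] (ν : Measure X) {f g : X → ℝ}
    (hf : Measurable f) (hg : Measurable g) (hf0 : ∀ x, 0 ≤ f x) (hg0 : ∀ x, 0 ≤ g x)
    {a b : ℝ} (ha : 0 ≤ a) (hb : 0 ≤ b) :
    ENNReal.ofReal a • ν.withDensity (fun x => ENNReal.ofReal (f x)) +
        ENNReal.ofReal b • ν.withDensity (fun x => ENNReal.ofReal (g x)) =
      ν.withDensity fun x => ENNReal.ofReal (a * f x + b * g x) := by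
  rw [← withDensity_smul _ hf.ennreal_ofReal, ← withDensity_smul _ hg.ennreal_ofReal,
    ← withDensity_add_left (hf.ennreal_ofReal.const_smul _)]
  congr 1
  funext x
  simp only [Pi.add_apply, Pi.smul_apply, smul_eq_mul]
  rw [ENNReal.ofReal_add (mul_nonneg ha (hf0 x)) (mul_nonneg hb (hg0 x)),
    ENNReal.ofReal_mul ha, ENNReal.ofReal_mul hb]

/-- A probability measure with density `f` has total mass `∫⁻ f = 1`. -/
theorem lintegral_eq_one_of_eq_withDensity {X : Type*} [MeasurableSpace X] {ν ρ : Measure X}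
    [IsProbabilityMeasure ρ] {f : X → ℝ≥0∞} (h : ρ = ν.withDensity f) :
    ∫⁻ x, f x ∂ν = 1 := by
  rw [← setLIntegral_univ, ← withDensity_apply _ MeasurableSet.univ, ← h, measure_univ]

theorem sconf_one_minus_weighted_integral_identity
    {X : Type*} [MeasurableSpace X] (ν : Measure X) [SigmaFinite ν]
    (pp pm : X → ℝ) (hppm : Measurable pp) (hpmm : Measurable pm)
    (hpp0 : ∀ x, 0 ≤ pp x) (hpm0 : ∀ x, 0 ≤ pm x)
    (μp μm : Measure X) [IsProbabilityMeasure μp] [IsProbabilityMeasure μm]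
    (hμp : μp = ν.withDensity fun x => ENNReal.ofReal (pp x))
    (hμm : μm = ν.withDensity fun x => ENNReal.ofReal (pm x))
    (πp πm : ℝ) (hπp0 : 0 < πp) (hπp1 : πp < 1) (hπm : πm = 1 - πp)
    (hpos : ∀ᵐ x ∂ν, 0 < πp * pp x + πm * pm x)
    (μ : Measure X) [IsProbabilityMeasure μ]
    (hμ : μ = ENNReal.ofReal πp • μp + ENNReal.ofReal πm • μm)
    (s : X → X → ℝ)
    (hs : ∀ x x', s x x' = (πp ^ 2 * pp x * pp x' + πm ^ 2 * pm x * pm x') /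
        ((πp * pp x + πm * pm x) * (πp * pp x' + πm * pm x')))
    (h : X → ℝ≥0∞) (hh : Measurable h) :
    (∫⁻ x, ∫⁻ x', ENNReal.ofReal (1 - s x x') * h x ∂μ ∂μ)
      = ENNReal.ofReal (πp * πm) * ((∫⁻ x, h x ∂μp) + ∫⁻ x, h x ∂μm) := by
  have hπm0 : 0 < πm := by linarith
  have hc : 0 ≤ πp * πm := by positivity
  have hP : Measurable fun x => ENNReal.ofReal (πp * pp x + πm * pm x) := by fun_prop
  have hμν : μ = ν.withDensity fun x => ENNReal.ofReal (πp * pp x + πm * pm x) := by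
    rw [hμ, hμp, hμm, smul_withDensity_ofReal_add_smul_withDensity_ofReal ν hppm hpmm hpp0 hpm0
      hπp0.le hπm0.le]
  have inner : ∀ x, 0 < πp * pp x + πm * pm x →
      ∫⁻ x', ENNReal.ofReal (1 - s x x') * h x ∂μ =
        ENNReal.ofReal (πp * πm * (pp x + pm x) / (πp * pp x + πm * pm x)) * h x := by
    intro x hx
    have hu : 0 ≤ πp * πm * pm x / (πp * pp x + πm * pm x) :=
      div_nonneg (mul_nonneg hc (hpm0 x)) hx.le
    have hv : 0 ≤ πp * πm * pp x / (πp * pp x + πm * pm x) :=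
      div_nonneg (mul_nonneg hc (hpp0 x)) hx.le
    have hsm : Measurable fun x' => ENNReal.ofReal (1 - s x x') := by
      simp only [hs]
      fun_prop
    rw [lintegral_mul_const _ hsm, hμν, lintegral_withDensity_eq_lintegral_mul _ hP hsm]
    congr 1
    calc
      _ = ∫⁻ x', (ENNReal.ofReal (πp * πm * pm x / (πp * pp x + πm * pm x)) *
              ENNReal.ofReal (pp x') +
            ENNReal.ofReal (πp * πm * pp x / (πp * pp x + πm * pm x)) *
              ENNReal.ofReal (pm x')) ∂ν := by
        refine lintegral_congr_ae ?_
        filter_upwards [hpos] with x' hx'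
        rw [Pi.mul_apply, ← ENNReal.ofReal_mul hx'.le, ← ENNReal.ofReal_mul hu,
          ← ENNReal.ofReal_mul hv,
          ← ENNReal.ofReal_add (mul_nonneg hu (hpp0 x')) (mul_nonneg hv (hpm0 x')), hs]
        congr 1
        have := hx.ne'
        have := hx'.ne'
        field_simp
        ring
      _ = _ := by
        rw [lintegral_add_left (hppm.ennreal_ofReal.const_mul _),
          lintegral_const_mul _ hppm.ennreal_ofReal, lintegral_const_mul _ hpmm.ennreal_ofReal,
          lintegral_eq_one_of_eq_withDensity hμp, lintegral_eq_one_of_eq_withDensity hμm,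
          mul_one, mul_one, ← ENNReal.ofReal_add hu hv]
        congr 1
        ring
  have hposμ : ∀ᵐ x ∂μ, 0 < πp * pp x + πm * pm x := by
    rw [hμν]
    exact (withDensity_absolutelyContinuous _ _).ae_le hpos
  rw [lintegral_congr_ae (hposμ.mono inner), hμν,
    lintegral_withDensity_eq_lintegral_mul _ hP (by fun_prop), hμp, hμm,
    lintegral_withDensity_eq_lintegral_mul _ hppm.ennreal_ofReal hh,
    lintegral_withDensity_eq_lintegral_mul _ hpmm.ennreal_ofReal hh,
    ← lintegral_add_left (hppm.ennreal_ofReal.mul hh),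
    ← lintegral_const_mul' _ _ ENNReal.ofReal_ne_top]
  refine lintegral_congr_ae ?_
  filter_upwards [hpos] with x hx
  simp only [Pi.mul_apply]
  rw [← add_mul, ← ENNReal.ofReal_add (hpp0 x) (hpm0 x), ← mul_assoc, ← mul_assoc,
    ← ENNReal.ofReal_mul hx.le, ← ENNReal.ofReal_mul hc, mul_div_cancel₀ _ hx.ne']
end

section
/- Probability of a negative partial empirical risk (Appendix lemma for Theorem 7): Fix a measurable classifier g: 𝒳 → ℝ such that ℓ(g(x),y) ≤ C_ℓ for all x ∈ 𝒳 and y ∈ {−1,+1}, and suppose there exist α > 0 and β > 0 with R₊(g) ≥ α and R₋(g) ≥ β. Then the probability (over the draw of the n i.i.d. pairs) that R̂₊(g) < 0 or R̂₋(g) < 0 is at most exp(−α²·(π₊−π₋)²·n/(2·C_ℓ²)) + exp(−β²·(π₊−π₋)²·n/(2·C_ℓ²)). -/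
open MeasureTheory ProbabilityTheory
open scoped ENNReal BigOperators

/-- Hoeffding's bound for the probability that a sum of i.i.d. bounded variables with mean at
least `m` is negative. -/
theorem measure_pi_sum_neg_le {Ω : Type*} [MeasurableSpace Ω] (P : Measure Ω)
    [IsProbabilityMeasure P] {Z : Ω → ℝ} (hZ : Measurable Z) {B m : ℝ} (hB : 0 < B)
    (hZB : ∀ x, |Z x| ≤ B) (hm : 0 ≤ m) (hmZ : m ≤ ∫ x, Z x ∂P) {n : ℕ} (hn : 0 < n) :
    (Measure.pi fun _ : Fin n => P) {ω | ∑ i, Z (ω i) < 0} ≤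
      ENNReal.ofReal (Real.exp (-(m ^ 2) * n / (2 * B ^ 2))) := by
  have hsub := (hasSubgaussianMGF_of_mem_Icc (μ := P) (a := -B) (b := B) hZ.aemeasurable
    (ae_of_all _ fun x => abs_le.mp (hZB x))).neg
  have hmeas : Measurable (-fun x => Z x - ∫ y, Z y ∂P) := (hZ.sub_const _).neg
  have hindep := iIndepFun_pi (ι := Fin n) (μ := fun _ => P)
    (X := fun _ => -fun x => Z x - ∫ y, Z y ∂P) fun _ => hmeas.aemeasurable
  have htail := HasSubgaussianMGF.measure_sum_ge_le_of_iIndepFun hindep (s := Finset.univ)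
    (c := fun _ => (‖B - -B‖₊ / 2) ^ 2) (ε := n * m)
    (fun i _ => HasSubgaussianMGF.of_map (Y := fun ω : Fin n → Ω => ω i)
      (X := -fun x => Z x - ∫ y, Z y ∂P) (measurable_pi_apply i).aemeasurable
      (by rwa [(measurePreserving_eval (fun _ : Fin n => P) i).map_eq])) (by positivity)
  have hvar : ((∑ _i : Fin n, (‖B - -B‖₊ / 2) ^ 2 : NNReal) : ℝ) = n * B ^ 2 := by
    have h : |B + B| = B + B := abs_of_pos (by linarith)
    simp [h]
  have hn' : (0 : ℝ) < n := by exact_mod_cast hn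
  rw [hvar] at htail
  rw [← ofReal_measureReal]
  refine ENNReal.ofReal_le_ofReal (((measureReal_mono fun ω hω => ?_).trans htail).trans_eq ?_)
  · simp only [Set.mem_ofPred_eq, Pi.neg_apply, neg_sub, Finset.sum_sub_distrib, Finset.sum_const,
      Finset.card_univ, Fintype.card_fin, nsmul_eq_mul] at hω ⊢
    nlinarith [mul_le_mul_of_nonneg_left hmZ hn'.le]
  · congr 1
    field_simp

theorem integral_density_ratio_mul {X : Type*} [MeasurableSpace X] (ν : Measure X) {u v : X → ℝ}
    (hu : Measurable u) (hv : Measurable v) (hu0 : ∀ x, 0 ≤ u x)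
    (hpos : ∀ᵐ x ∂ν, 0 < u x + v x) (f : X → ℝ) :
    ∫ x, u x / (u x + v x) * f x ∂(ν.withDensity fun x => ENNReal.ofReal (u x + v x)) =
      ∫ x, f x ∂(ν.withDensity fun x => ENNReal.ofReal (u x)) := by
  rw [integral_withDensity_eq_integral_toReal_smul
      (f := fun x => ENNReal.ofReal (u x + v x)) (hu.add hv).ennreal_ofReal (by simp),
    integral_withDensity_eq_integral_toReal_smul hu.ennreal_ofReal (by simp)]
  refine integral_congr_ae ?_
  filter_upwards [hpos] with x hx
  rw [ENNReal.toReal_ofReal hx.le, ENNReal.toReal_ofReal (hu0 x), smul_eq_mul, smul_eq_mul]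
  field_simp

theorem withDensity_ofReal_const_mul {X : Type*} [MeasurableSpace X] (ν : Measure X) {c : ℝ}
    (hc : 0 ≤ c) (q : X → ℝ) :
    (ν.withDensity fun x => ENNReal.ofReal (c * q x)) =
      ENNReal.ofReal c • ν.withDensity fun x => ENNReal.ofReal (q x) := by
  rw [← withDensity_smul' _ _ ENNReal.ofReal_ne_top]
  congr 1
  ext x
  simp [ENNReal.ofReal_mul hc]

/-- The mean of a similarity-weighted loss, in terms of the two posteriors `a` and `b`. -/
theorem integral_similarity_sub_mul_add {X : Type*} [MeasurableSpace X] (μ : Measure X)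
    [IsProbabilityMeasure μ] {a b f : X → ℝ} (ha : Integrable a μ) (hb : Integrable b μ)
    (hf : Integrable f μ) (haf : Integrable (fun x => a x * f x) μ)
    (hbf : Integrable (fun x => b x * f x) μ) (hab : ∀ᵐ x ∂μ, a x + b x = 1) :
    ∫ z, (a z.1 * a z.2 + b z.1 * b z.2 - ∫ x, b x ∂μ) * (f z.1 + f z.2) ∂(μ.prod μ) =
      2 * (∫ x, a x ∂μ - ∫ x, b x ∂μ) * ∫ x, a x * f x ∂μ := by
  set β := ∫ x, b x ∂μ
  have hsplit : ∫ x, f x ∂μ = ∫ x, a x * f x ∂μ + ∫ x, b x * f x ∂μ := by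
    rw [← integral_add haf hbf]
    refine integral_congr_ae ?_
    filter_upwards [hab] with x hx
    rw [← add_mul, hx, one_mul]
  have h1 : Integrable (fun z : X × X => a z.1 * f z.1 * a z.2 + b z.1 * f z.1 * b z.2)
      (μ.prod μ) := (haf.mul_prod ha).add (hbf.mul_prod hb)
  have h2 : Integrable (fun z : X × X => a z.1 * (a z.2 * f z.2) + b z.1 * (b z.2 * f z.2))
      (μ.prod μ) := (ha.mul_prod haf).add (hb.mul_prod hbf)
  have h3 : Integrable (fun z : X × X => β * (f z.1 + f z.2)) (μ.prod μ) :=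
    ((hf.comp_fst μ).add (hf.comp_snd μ)).const_mul β
  calc _ = ∫ z, ((a z.1 * f z.1 * a z.2 + b z.1 * f z.1 * b z.2) +
          (a z.1 * (a z.2 * f z.2) + b z.1 * (b z.2 * f z.2))) -
          β * (f z.1 + f z.2) ∂(μ.prod μ) := by
        congr 1; ext z; ring
    _ = _ := by
        rw [integral_sub (by exact h1.add h2) h3, integral_add h1 h2,
          integral_add (haf.mul_prod ha) (hbf.mul_prod hb),
          integral_add (ha.mul_prod haf) (hb.mul_prod hbf), integral_const_mul,
          integral_add (hf.comp_fst μ) (hf.comp_snd μ),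
          integral_prod_mul (fun x => a x * f x) a,
          integral_prod_mul (fun x => b x * f x) b, integral_prod_mul a (fun x => a x * f x),
          integral_prod_mul b (fun x => b x * f x), integral_fun_fst, integral_fun_snd, hsplit]
        simp only [probReal_univ, one_smul]
        ring

/-- The tail bound for one partial empirical risk; the other one follows by exchanging the
roles of the two classes. -/
theorem measure_pi_partial_risk_neg_le {X : Type*} [MeasurableSpace X] (ν : Measure X)
    {p q : X → ℝ} (hp : Measurable p) (hq : Measurable q) (hp0 : ∀ x, 0 ≤ p x)
    (hq0 : ∀ x, 0 ≤ q x) {P Q μ : Measure X} [IsProbabilityMeasure P] [IsProbabilityMeasure Q]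
    [IsProbabilityMeasure μ] (hP : P = ν.withDensity fun x => ENNReal.ofReal (p x))
    (hQ : Q = ν.withDensity fun x => ENNReal.ofReal (q x)) {c d : ℝ} (hc : 0 < c) (hd : 0 < d)
    (hcd : c + d = 1) (hne : c ≠ d) (hpos : ∀ᵐ x ∂ν, 0 < c * p x + d * q x)
    (hμ : μ = ENNReal.ofReal c • P + ENNReal.ofReal d • Q) {f : X → ℝ} (hf : Measurable f)
    (hf0 : ∀ x, 0 ≤ f x) {C : ℝ} (hC : 0 < C) (hfC : ∀ x, f x ≤ C) {α : ℝ} (hα : 0 < α)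
    (hαf : α ≤ c * ∫ x, f x ∂P) {n : ℕ} (hn : 0 < n) :
    (Measure.pi fun _ : Fin n => μ.prod μ)
        {ω | (1 / (2 * (n : ℝ) * (c - d))) * ∑ i,
          ((c ^ 2 * p (ω i).1 * p (ω i).2 + d ^ 2 * q (ω i).1 * q (ω i).2) /
            ((c * p (ω i).1 + d * q (ω i).1) * (c * p (ω i).2 + d * q (ω i).2)) - d) *
            (f (ω i).1 + f (ω i).2) < 0} ≤
      ENNReal.ofReal (Real.exp (-(α ^ 2) * (c - d) ^ 2 * n / (2 * C ^ 2))) := by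
  have hu : Measurable fun x => c * p x := hp.const_mul c
  have hv : Measurable fun x => d * q x := hq.const_mul d
  have hu0 : ∀ x, 0 ≤ c * p x := fun x => mul_nonneg hc.le (hp0 x)
  have hv0 : ∀ x, 0 ≤ d * q x := fun x => mul_nonneg hd.le (hq0 x)
  have hμ' : μ = ν.withDensity fun x => ENNReal.ofReal (c * p x + d * q x) := by
    rw [hμ, hP, hQ, ← withDensity_ofReal_const_mul ν hc.le, ← withDensity_ofReal_const_mul ν hd.le,
      ← withDensity_add_left hu.ennreal_ofReal]
    congr 1
    ext x
    simp [ENNReal.ofReal_add (hu0 x) (hv0 x)]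
  set a : X → ℝ := fun x => c * p x / (c * p x + d * q x) with ha_def
  set b : X → ℝ := fun x => d * q x / (c * p x + d * q x) with hb_def
  have ha : Measurable a := hu.div (hu.add hv)
  have hb : Measurable b := hv.div (hu.add hv)
  have ha0 : ∀ x, 0 ≤ a x := fun x => div_nonneg (hu0 x) (add_nonneg (hu0 x) (hv0 x))
  have hb0 : ∀ x, 0 ≤ b x := fun x => div_nonneg (hv0 x) (add_nonneg (hu0 x) (hv0 x))
  have hab1 : ∀ x, a x + b x ≤ 1 := fun x => by
    rw [ha_def, hb_def, ← add_div]
    exact div_self_le_one _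
  have hab : ∀ᵐ x ∂μ, a x + b x = 1 := by
    have hac : μ ≪ ν := hμ' ▸ withDensity_absolutelyContinuous _ _
    filter_upwards [hac.ae_le hpos] with x hx
    rw [ha_def, hb_def, ← add_div, div_self hx.ne']
  have haf : ∀ h : X → ℝ, ∫ x, a x * h x ∂μ = c * ∫ x, h x ∂P := fun h => by
    rw [hμ', integral_density_ratio_mul ν hu hv hu0 hpos, withDensity_ofReal_const_mul ν hc.le,
      ← hP, integral_smul_measure, ENNReal.toReal_ofReal hc.le, smul_eq_mul]
  have hbf : ∀ h : X → ℝ, ∫ x, b x * h x ∂μ = d * ∫ x, h x ∂Q := fun h => by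
    have h1 := integral_density_ratio_mul ν hv hu hv0
      (by filter_upwards [hpos] with x hx using by linarith) h
    simp only [add_comm (d * q _)] at h1
    rw [hμ', h1, withDensity_ofReal_const_mul ν hd.le, ← hQ, integral_smul_measure,
      ENNReal.toReal_ofReal hd.le, smul_eq_mul]
  have ha_int : ∫ x, a x ∂μ = c := by simpa using haf fun _ => 1
  have hb_int : ∫ x, b x ∂μ = d := by simpa using hbf fun _ => 1
  have hbdd : ∀ {h : X → ℝ} {K : ℝ}, Measurable h → (∀ x, 0 ≤ h x) → (∀ x, h x ≤ K) →
      Integrable h μ := fun hm h0 hK =>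
    Integrable.of_mem_Icc 0 _ hm.aemeasurable (ae_of_all _ fun x => ⟨h0 x, hK x⟩)
  have ha1 : ∀ x, a x ≤ 1 := fun x => by linarith [hab1 x, hb0 x]
  have hb1 : ∀ x, b x ≤ 1 := fun x => by linarith [hab1 x, ha0 x]
  have hmean := integral_similarity_sub_mul_add μ (hbdd ha ha0 ha1) (hbdd hb hb0 hb1)
    (hbdd hf hf0 hfC)
    (hbdd (ha.mul hf) (fun x => mul_nonneg (ha0 x) (hf0 x)) (K := 1 * C)
      fun x => mul_le_mul (ha1 x) (hfC x) (hf0 x) zero_le_one)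
    (hbdd (hb.mul hf) (fun x => mul_nonneg (hb0 x) (hf0 x)) (K := 1 * C)
      fun x => mul_le_mul (hb1 x) (hfC x) (hf0 x) zero_le_one) hab
  rw [ha_int, hb_int, haf] at hmean
  have hcd0 : c - d ≠ 0 := sub_ne_zero.mpr hne
  have hcd_abs : 0 < |c - d| := abs_pos.mpr hcd0
  set Z : X × X → ℝ := fun z =>
    1 / (2 * (c - d)) * ((a z.1 * a z.2 + b z.1 * b z.2 - d) * (f z.1 + f z.2)) with hZ_def
  have hZ : Measurable Z := by fun_prop
  have hZB : ∀ z, |Z z| ≤ C / |c - d| := fun z => by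
    have hs0 : 0 ≤ a z.1 * a z.2 + b z.1 * b z.2 :=
      add_nonneg (mul_nonneg (ha0 _) (ha0 _)) (mul_nonneg (hb0 _) (hb0 _))
    have hs1 : a z.1 * a z.2 + b z.1 * b z.2 ≤ 1 := by
      nlinarith [hab1 z.1, mul_le_mul_of_nonneg_left (ha1 z.2) (ha0 z.1),
        mul_le_mul_of_nonneg_left (hb1 z.2) (hb0 z.1)]
    have hsd : |a z.1 * a z.2 + b z.1 * b z.2 - d| ≤ 1 := abs_le.mpr ⟨by linarith, by linarith⟩
    have hff : |f z.1 + f z.2| ≤ 2 * C := by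
      rw [abs_of_nonneg (add_nonneg (hf0 _) (hf0 _))]
      linarith [hfC z.1, hfC z.2]
    rw [hZ_def]
    simp only [abs_mul, abs_div, abs_one, abs_two]
    calc _ ≤ 1 / (2 * |c - d|) * (1 * (2 * C)) := by gcongr
      _ = C / |c - d| := by field_simp
  have hZm : α ≤ ∫ z, Z z ∂(μ.prod μ) := by
    rw [hZ_def, integral_const_mul, hmean]
    refine hαf.trans_eq ?_
    field_simp
  have htail := measure_pi_sum_neg_le (μ.prod μ) hZ (div_pos hC hcd_abs) hZB hα.le hZm hn
  have hn' : (0 : ℝ) < n := by exact_mod_cast hn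
  refine (measure_mono fun ω hω => ?_).trans (htail.trans_eq ?_)
  · have hs : ∀ x y, (c ^ 2 * p x * p y + d ^ 2 * q x * q y) /
        ((c * p x + d * q x) * (c * p y + d * q y)) = a x * a y + b x * b y := fun x y => by
      simp only [ha_def, hb_def, div_mul_div_comm, ← add_div]
      congr 1
      ring
    simp only [Set.mem_ofPred_eq, hs] at hω
    simp only [Set.mem_ofPred_eq, hZ_def, ← Finset.mul_sum]
    refine (mul_lt_mul_iff_of_pos_left (inv_pos.mpr hn')).mp ?_
    rw [mul_zero]
    refine lt_of_eq_of_lt ?_ hω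
    rw [← mul_assoc]
    congr 1
    field_simp
  · congr 2
    rw [div_pow, sq_abs]
    field_simp

theorem sconf_negative_partial_risk_probability
    {X : Type*} [MeasurableSpace X] (ν : Measure X) [SigmaFinite ν]
    (pp pm : X → ℝ) (hppm : Measurable pp) (hpmm : Measurable pm)
    (hpp0 : ∀ x, 0 ≤ pp x) (hpm0 : ∀ x, 0 ≤ pm x)
    (μp μm : Measure X) [IsProbabilityMeasure μp] [IsProbabilityMeasure μm]
    (hμp : μp = ν.withDensity fun x => ENNReal.ofReal (pp x))
    (hμm : μm = ν.withDensity fun x => ENNReal.ofReal (pm x))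
    (πp πm : ℝ) (hπp0 : 0 < πp) (hπp1 : πp < 1) (hπm : πm = 1 - πp)
    (hpos : ∀ᵐ x ∂ν, 0 < πp * pp x + πm * pm x)
    (μ : Measure X) [IsProbabilityMeasure μ]
    (hμ : μ = ENNReal.ofReal πp • μp + ENNReal.ofReal πm • μm)
    (s : X → X → ℝ)
    (hs : ∀ x x', s x x' = (πp ^ 2 * pp x * pp x' + πm ^ 2 * pm x * pm x') /
        ((πp * pp x + πm * pm x) * (πp * pp x' + πm * pm x')))
    (hne : πp ≠ πm)
    (ℓ : ℝ → ℝ → ℝ)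
    (hℓm1 : Measurable fun z => ℓ z 1) (hℓm2 : Measurable fun z => ℓ z (-1))
    (hℓ01 : ∀ z, 0 ≤ ℓ z 1) (hℓ02 : ∀ z, 0 ≤ ℓ z (-1))
    (g : X → ℝ) (hg : Measurable g)
    (n : ℕ) (hn : 0 < n)
    (Rhatp Rhatm : (X → ℝ) → (Fin n → X × X) → ℝ)
    (hRhatp : ∀ g ω, Rhatp g ω = (1 / (2 * (n : ℝ) * (πp - πm))) *
        ∑ i, (s (ω i).1 (ω i).2 - πm) * (ℓ (g (ω i).1) 1 + ℓ (g (ω i).2) 1))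
    (hRhatm : ∀ g ω, Rhatm g ω = (1 / (2 * (n : ℝ) * (πp - πm))) *
        ∑ i, (πp - s (ω i).1 (ω i).2) * (ℓ (g (ω i).1) (-1) + ℓ (g (ω i).2) (-1)))
    (Cl : ℝ) (hCl0 : 0 < Cl)
    (hgb : ∀ x, ℓ (g x) 1 ≤ Cl ∧ ℓ (g x) (-1) ≤ Cl)
    (α β : ℝ) (hα : 0 < α) (hβ : 0 < β)
    (hRpα : α ≤ πp * ∫ x, ℓ (g x) 1 ∂μp)
    (hRmβ : β ≤ πm * ∫ x, ℓ (g x) (-1) ∂μm) :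
    (Measure.pi fun _ : Fin n => μ.prod μ)
        {ω | Rhatp g ω < 0 ∨ Rhatm g ω < 0} ≤
      ENNReal.ofReal
        (Real.exp (-(α ^ 2) * (πp - πm) ^ 2 * n / (2 * Cl ^ 2)) +
         Real.exp (-(β ^ 2) * (πp - πm) ^ 2 * n / (2 * Cl ^ 2))) := by
  have hπm0 : 0 < πm := by linarith
  have hp := measure_pi_partial_risk_neg_le ν hppm hpmm hpp0 hpm0 hμp hμm hπp0 hπm0 (by linarith)
    hne hpos hμ (hℓm1.comp hg) (fun x => hℓ01 (g x)) hCl0 (fun x => (hgb x).1) hα hRpα hn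
  have hm := measure_pi_partial_risk_neg_le ν hpmm hppm hpm0 hpp0 hμm hμp hπm0 hπp0 (by linarith)
    hne.symm (by filter_upwards [hpos] with x hx using by linarith) (hμ.trans (add_comm _ _))
    (hℓm2.comp hg) (fun x => hℓ02 (g x)) hCl0 (fun x => (hgb x).2) hβ hRmβ hn
  rw [ENNReal.ofReal_add (Real.exp_pos _).le (Real.exp_pos _).le, Set.ofPred_or]
  refine (measure_union_le _ _).trans (add_le_add ?_ ?_)
  · simpa only [hRhatp, hs, Function.comp_apply] using hp
  · rw [← neg_sub πm πp, neg_sq]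
    refine (measure_mono fun ω hω => ?_).trans hm
    have hs' : ∀ x y, (πm ^ 2 * pm x * pm y + πp ^ 2 * pp x * pp y) /
        ((πm * pm x + πp * pp x) * (πm * pm y + πp * pp y)) = s x y := fun x y => by
      rw [hs, add_comm (πm ^ 2 * _ * _), add_comm (πm * pm x), add_comm (πm * pm y)]
    simp only [Set.mem_ofPred_eq, hRhatm, Function.comp_apply, hs'] at hω ⊢
    refine lt_of_eq_of_lt ?_ hω
    rw [← neg_sub πm πp, mul_neg, div_neg, neg_mul, ← mul_neg, ← Finset.sum_neg_distrib]
    congr 2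
    ext i
    ring
end
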